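/- There is an absolute constant K > 0 such that the following holds. Let T be a positive integer, let z_1,…,z_T ≥ 0, u_1,…,u_T ≥ 0, h_1,…,h_T > 0 and ĥ_1,…,ĥ_{T+1} > 0 with h_t ≤ ĥ_t for all t ∈ [T], and let z_max, u_max, ĥ_max denote the maxima of the respective sequences over t ∈ [T]. Suppose (β_t)_{t=1}^T is given by Rule 2: β_1 > 0 is arbitrary and β_t = β_{t−1} + (1/ĥ_t)(2√(z_{t−1}/β_{t−1}) + u_{t−1}/β_{t−1}) for t = 2,…,T. Then for every ε ≥ 1/T, F(β_{1:T}, z_{1:T}, u_{1:T}, h_{1:T}) ≤ K · [ min{ (∑_{t=1}^T √(z_t ĥ_{t+1} ln(εT)))^{2/3} + (√(z_max ĥ_max)/ε)^{2/3} , (∑_{t=1}^T √(z_t ĥ_max))^{2/3} } + min{ √(∑_{t=1}^T u_t ĥ_{t+1} ln(εT)) + √(u_max ĥ_max/ε) , √(∑_{t=1}^T u_t ĥ_max) } + √(z_max/β_1) + u_max/β_1 + β_1 h_1 ]. -/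

import Mathlib

open Finset

/-- `F(β_{1:T}, z_{1:T}, u_{1:T}, h_{1:T})
  = ∑_{t=1}^T ( 2√(z_t/β_t) + u_t/β_t + (β_t − β_{t−1}) h_t )`, where `β 0 = 0`. -/
noncomputable def F (T : ℕ) (β z u h : ℕ → ℝ) : ℝ :=
  ∑ t ∈ Finset.Icc 1 T,
    (2 * Real.sqrt (z t / β t) + u t / β t + (β t - β (t - 1)) * h t)

/-- telescoping with cutoff -/
lemma aux_tele (φ : ℝ → ℝ) (G f : ℕ → ℝ) (Θ : ℝ) (n : ℕ) (P : ℕ → Prop) [DecidablePred P]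
    (hφ0 : 0 ≤ φ (min (G 0) Θ))
    (hmono : ∀ i < n, φ (min (G i) Θ) ≤ φ (min (G (i+1)) Θ))
    (hG : ∀ i < n, G i ≤ G (i+1))
    (hP : ∀ i < n, P i → G (i+1) ≤ Θ)
    (hstep : ∀ i < n, P i → f i ≤ φ (G (i+1)) - φ (G i)) :
    ∑ i ∈ (range n).filter P, f i ≤ φ (min (G n) Θ) := by
  induction n with
  | zero => simpa using hφ0
  | succ n ih =>
    have ih' := ih (fun i hi => hmono i (by omega)) (fun i hi => hG i (by omega))
      (fun i hi => hP i (by omega)) (fun i hi => hstep i (by omega))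
    rw [range_add_one, filter_insert]
    split_ifs with h
    · rw [sum_insert (by simp)]
      have h1 := hP n (by omega) h
      have h2 := hG n (by omega)
      have h3 := hstep n (by omega) h
      rw [min_eq_left h1]
      rw [min_eq_left (h2.trans h1)] at ih'
      linarith
    · exact ih'.trans (hmono n (by omega))

lemma aux_pow_step (p a b : ℝ) (hp0 : 0 < p) (hp1 : p < 1) (ha : 0 ≤ a) (hab : a ≤ b) :
    (b - a) * b ^ (-p) ≤ (1 - p)⁻¹ * b ^ (1 - p) - (1 - p)⁻¹ * a ^ (1 - p) := by
  rcases (ha.trans hab).eq_or_lt with hb | hb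
  · have : a = 0 := by linarith
    subst this; subst hb; simp
  have hq : 0 < 1 - p := by linarith
  have h1 := Real.geom_mean_le_arith_mean2_weighted hq.le hp0.le ha hb.le (by ring)
  have hbp : 0 < b ^ (-p) := Real.rpow_pos_of_pos hb _
  have h2 : b ^ p * b ^ (-p) = 1 := by rw [← Real.rpow_add hb]; simp
  have h3 : b ^ (1-p) = b * b ^ (-p) := by
    rw [sub_eq_add_neg, Real.rpow_add hb, Real.rpow_one]
  have h4 : a ^ (1-p) ≤ ((1-p)*a + p*b) * b ^ (-p) := by
    calc a ^ (1-p) = (a ^ (1-p) * b ^ p) * b ^ (-p) := by rw [mul_assoc, h2, mul_one]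
      _ ≤ _ := by gcongr
  rw [← mul_sub, h3, inv_mul_eq_div, le_div_iff₀ hq]
  nlinarith

/-- bound 2 with cutoff -/
lemma aux_low (p : ℝ) (hp0 : 0 < p) (hp1 : p < 1) (n : ℕ) (w g : ℕ → ℝ) (M L : ℝ) (hM : 0 < M)
    (hL : 0 ≤ L)
    (hw : ∀ i < n, 0 ≤ w i) (hg : ∀ i < n, 0 < g i) (hgM : ∀ i < n, g i ≤ M)
    (P : ℕ → Prop) [DecidablePred P]
    (hP : ∀ i < n, P i → ∑ j ∈ range (i+1), w j ≤ L) :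
    ∑ i ∈ (range n).filter P, w i * (∑ j ∈ range (i+1), w j / g j) ^ (-p)
      ≤ (1 - p)⁻¹ * (M ^ p * L ^ (1-p)) := by
  have hq : 0 < 1 - p := by linarith
  have hS0 : ∀ i ≤ n, 0 ≤ ∑ j ∈ range i, w j := fun i hi =>
    sum_nonneg fun j hj => hw j (by have := mem_range.1 hj; omega)
  have hSm : ∀ i < n, ∑ j ∈ range i, w j ≤ ∑ j ∈ range (i+1), w j := fun i hi => by
    rw [sum_range_succ]; linarith [hw i hi]
  have key := aux_tele (fun x => (1-p)⁻¹ * x ^ (1-p)) (fun k => ∑ j ∈ range k, w j)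
    (fun i => w i * (∑ j ∈ range (i+1), w j) ^ (-p)) L n P
    (by
      have : (0:ℝ) ≤ min (∑ j ∈ range 0, w j) L := by simp [hL]
      positivity)
    (by
      intro i hi
      have h1 : (0:ℝ) ≤ min (∑ j ∈ range i, w j) L := le_min (hS0 i hi.le) hL
      have h2 := hSm i hi
      have : min (∑ j ∈ range i, w j) L ≤ min (∑ j ∈ range (i+1), w j) L := min_le_min_right _ h2
      gcongr)
    hSm hP
    (by
      intro i hi _
      have := aux_pow_step p _ _ hp0 hp1 (hS0 i hi.le) (hSm i hi)
      have e : ∑ j ∈ range (i+1), w j - ∑ j ∈ range i, w j = w i := by rw [sum_range_succ]; ring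
      rw [e] at this
      exact this)
  have h3 : (fun x : ℝ => (1-p)⁻¹ * x ^ (1-p)) (min (∑ j ∈ range n, w j) L) ≤ (1-p)⁻¹ * L ^ (1-p) := by
    have h1 : (0:ℝ) ≤ min (∑ j ∈ range n, w j) L := le_min (hS0 n le_rfl) hL
    have : min (∑ j ∈ range n, w j) L ≤ L := min_le_right _ _
    dsimp only
    gcongr
  have h4 : ∑ i ∈ (range n).filter P, w i * (∑ j ∈ range (i+1), w j / g j) ^ (-p)
      ≤ ∑ i ∈ (range n).filter P, M ^ p * (w i * (∑ j ∈ range (i+1), w j) ^ (-p)) := by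
    apply sum_le_sum
    intro i hi
    have hi' : i < n := mem_range.1 (mem_filter.1 hi).1
    rcases (hw i hi').eq_or_lt with h0 | h0
    · simp [← h0]
    have hSpos : 0 < ∑ j ∈ range (i+1), w j := by
      rw [sum_range_succ]; linarith [hS0 i hi'.le]
    have hle : (∑ j ∈ range (i+1), w j) / M ≤ ∑ j ∈ range (i+1), w j / g j := by
      rw [sum_div]
      apply sum_le_sum
      intro j hj
      have hj' : j < n := by have := mem_range.1 hj; omega
      have := hw j hj'; have := hg j hj'; have := hgM j hj'
      gcongr
    have h5 : (∑ j ∈ range (i+1), w j / g j) ^ (-p) ≤ ((∑ j ∈ range (i+1), w j) / M) ^ (-p) :=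
      Real.rpow_le_rpow_of_nonpos (by positivity) hle (by linarith)
    have h6 : ((∑ j ∈ range (i+1), w j) / M) ^ (-p) = M ^ p * (∑ j ∈ range (i+1), w j) ^ (-p) := by
      rw [Real.div_rpow hSpos.le hM.le, Real.rpow_neg hM.le, div_inv_eq_mul, mul_comm]
    rw [h6] at h5
    calc _ ≤ w i * (M ^ p * (∑ j ∈ range (i+1), w j) ^ (-p)) := by gcongr
      _ = _ := by ring
  rw [← mul_sum] at h4
  have hMp : 0 < M ^ p := Real.rpow_pos_of_pos hM _
  calc _ ≤ _ := h4
    _ ≤ M ^ p * ((1-p)⁻¹ * L ^ (1-p)) := by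
      gcongr
      exact key.trans h3
    _ = _ := by ring

lemma aux_bound2 (p : ℝ) (hp0 : 0 < p) (hp1 : p < 1) (n : ℕ) (w g : ℕ → ℝ) (M : ℝ) (hM : 0 < M)
    (hw : ∀ i < n, 0 ≤ w i) (hg : ∀ i < n, 0 < g i) (hgM : ∀ i < n, g i ≤ M) :
    ∑ i ∈ range n, w i * (∑ j ∈ range (i+1), w j / g j) ^ (-p)
      ≤ (1 - p)⁻¹ * (M ^ p * (∑ i ∈ range n, w i) ^ (1-p)) := by
  have := aux_low p hp0 hp1 n w g M (∑ i ∈ range n, w i) hM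
    (sum_nonneg fun j hj => hw j (mem_range.1 hj)) hw hg hgM (fun _ => True) (by
      intro i hi _
      apply sum_le_sum_of_subset_of_nonneg
      · intro j hj; simp at *; omega
      · intro j hj _; exact hw j (mem_range.1 hj))
  simpa using this

lemma aux_log (n : ℕ) (a : ℕ → ℝ) (θ Θ : ℝ) (hθ : 0 < θ) (hΘ : 0 < Θ) (ha : ∀ i < n, 0 ≤ a i)
    (P : ℕ → Prop) [DecidablePred P]
    (hP : ∀ i < n, P i → ∑ j ∈ range (i+1), a j ≤ Θ)
    (hP' : ∀ i < n, P i → θ ≤ ∑ j ∈ range (i+1), a j) :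
    ∑ i ∈ (range n).filter P, a i / (∑ j ∈ range (i+1), a j) ≤ 2 * Real.log ((θ + Θ) / θ) := by
  have hS0 : ∀ i ≤ n, 0 ≤ ∑ j ∈ range i, a j := fun i hi =>
    sum_nonneg fun j hj => ha j (by have := mem_range.1 hj; omega)
  have hSm : ∀ i < n, ∑ j ∈ range i, a j ≤ ∑ j ∈ range (i+1), a j := fun i hi => by
    rw [sum_range_succ]; linarith [ha i hi]
  have key := aux_tele (fun x => 2 * Real.log ((θ + x) / θ)) (fun k => ∑ j ∈ range k, a j)
    (fun i => a i / (∑ j ∈ range (i+1), a j)) Θ n P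
    (by simp [min_eq_left hΘ.le, hθ.ne'])
    (by
      intro i hi
      have h1 : (0:ℝ) ≤ min (∑ j ∈ range i, a j) Θ := le_min (hS0 i hi.le) hΘ.le
      have h2 := hSm i hi
      have : min (∑ j ∈ range i, a j) Θ ≤ min (∑ j ∈ range (i+1), a j) Θ := min_le_min_right _ h2
      gcongr)
    hSm hP
    (by
      intro i hi hPi
      have h1 := hP' i hi hPi
      have h2 := hS0 i hi.le
      have e : ∑ j ∈ range (i+1), a j = ∑ j ∈ range i, a j + a i := by rw [sum_range_succ]
      have hai := ha i hi
      rw [e] at h1 ⊢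
      set s := ∑ j ∈ range i, a j
      rw [← mul_sub, ← Real.log_div (by positivity) (by positivity)]
      have h3 : (θ + (s + a i)) / θ / ((θ + s) / θ) = (θ + (s + a i)) / (θ + s) := by
        field_simp
      rw [h3]
      have h4 := Real.one_sub_inv_le_log_of_pos (x := (θ + (s + a i)) / (θ + s)) (by positivity)
      rw [inv_div] at h4
      have h5 : 1 - (θ + s) / (θ + (s + a i)) = a i / (θ + (s + a i)) := by
        have : θ + (s + a i) ≠ 0 := by positivity
        field_simp; ring
      rw [h5] at h4
      have h6 : a i / (s + a i) ≤ 2 * (a i / (θ + (s + a i))) := by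
        have : 0 < s + a i := by linarith
        rw [← mul_div_assoc, div_le_div_iff₀ this (by positivity)]
        nlinarith
      linarith)
  refine key.trans ?_
  have h1 : (0:ℝ) ≤ min (∑ j ∈ range n, a j) Θ := le_min (hS0 n le_rfl) hΘ.le
  have : min (∑ j ∈ range n, a j) Θ ≤ Θ := min_le_right _ _
  gcongr

lemma aux_holder (p : ℝ) (hp0 : 0 < p) (hp1 : p < 1) (s : Finset ℕ) (x y : ℕ → ℝ)
    (hx : ∀ i ∈ s, 0 ≤ x i) (hy : ∀ i ∈ s, 0 ≤ y i) :
    ∑ i ∈ s, x i ^ (1-p) * y i ^ p ≤ (∑ i ∈ s, x i) ^ (1-p) * (∑ i ∈ s, y i) ^ p := by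
  have hq : 0 < 1 - p := by linarith
  have hc : Real.HolderConjugate (1-p)⁻¹ p⁻¹ := by
    rw [Real.holderConjugate_iff]
    constructor
    · rw [one_lt_inv₀ hq]; linarith
    · simp
  have := Real.inner_le_Lp_mul_Lq_of_nonneg s hc (f := fun i => x i ^ (1-p)) (g := fun i => y i ^ p)
    (fun i hi => Real.rpow_nonneg (hx i hi) _) (fun i hi => Real.rpow_nonneg (hy i hi) _)
  have e1 : ∑ i ∈ s, (x i ^ (1-p)) ^ (1-p)⁻¹ = ∑ i ∈ s, x i := sum_congr rfl fun i hi => by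
    rw [← Real.rpow_mul (hx i hi), mul_inv_cancel₀ hq.ne', Real.rpow_one]
  have e2 : ∑ i ∈ s, (y i ^ p) ^ p⁻¹ = ∑ i ∈ s, y i := sum_congr rfl fun i hi => by
    rw [← Real.rpow_mul (hy i hi), mul_inv_cancel₀ hp0.ne', Real.rpow_one]
  rw [e1, e2] at this
  simpa using this

lemma aux_mid_term (p w g G : ℝ) (hp0 : 0 < p) (hp1 : p < 1) (hw : 0 ≤ w) (hg : 0 < g)
    (hG : 0 ≤ G) :
    w * G ^ (-p) = (w * g ^ (p / (1-p))) ^ (1-p) * ((w / g) / G) ^ p := by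
  have hq : 0 < 1 - p := by linarith
  rcases hw.eq_or_lt with h0 | h0
  · subst h0
    simp [Real.zero_rpow hp0.ne']
  rw [Real.mul_rpow hw (by positivity), ← Real.rpow_mul hg.le, div_mul_cancel₀ _ hq.ne',
    Real.div_rpow (by positivity) hG, Real.div_rpow hw hg.le, Real.rpow_neg hG]
  have e : w ^ (1-p) * w ^ p = w := by rw [← Real.rpow_add h0]; simp
  have hgp : 0 < g ^ p := Real.rpow_pos_of_pos hg _
  calc w * (G ^ p)⁻¹ = (w ^ (1-p) * w ^ p) * (G ^ p)⁻¹ := by rw [e]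
    _ = _ := by field_simp

lemma aux_core1 (p : ℝ) (hp0 : 0 < p) (hp1 : p < 1) (n T : ℕ) (hnT : n ≤ T) (w g : ℕ → ℝ)
    (M W ε : ℝ) (hM : 0 < M) (hW : 0 < W) (hε : 0 < ε)
    (hL : 1 ≤ Real.log (ε * T))
    (hw : ∀ i < n, 0 ≤ w i) (hwW : ∀ i < n, w i ≤ W)
    (hg : ∀ i < n, 0 < g i) (hgM : ∀ i < n, g i ≤ M) :
    ∑ i ∈ range n, w i * (∑ j ∈ range (i+1), w j / g j) ^ (-p)
      ≤ ((2 * (1 + p⁻¹)) ^ p) *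
          (∑ i ∈ range n, w i * (g i * Real.log (ε * T)) ^ (p / (1-p))) ^ (1-p)
        + ((1-p)⁻¹ + 1) * (M ^ p * (W / ε) ^ (1-p)) := by
  classical
  have hq : 0 < 1 - p := by linarith
  set L := Real.log (ε * T) with hLdef
  set θ := W / (ε * M) with hθdef
  have hθ : 0 < θ := by positivity
  have hx0 : 0 < ε * T := by
    by_contra hcon
    have hT0 : (0:ℝ) ≤ ε * T := by positivity
    have : ε * T = 0 := by linarith
    rw [hLdef, this] at hL
    simp at hL; linarith
  have hx1 : 1 ≤ ε * T := by
    by_contra hcon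
    have := Real.log_nonpos hx0.le (not_le.1 hcon).le
    linarith
  set Θ := θ * (ε * T) ^ p⁻¹ with hΘdef
  have hxp : 1 ≤ (ε * T) ^ p⁻¹ := Real.one_le_rpow hx1 (by positivity)
  have hΘ : 0 < Θ := by positivity
  have hG0 : ∀ i ≤ n, 0 ≤ ∑ j ∈ range i, w j / g j := fun i hi =>
    sum_nonneg fun j hj => by
      have hj' : j < n := by have := mem_range.1 hj; omega
      exact div_nonneg (hw j hj') (hg j hj').le
  let P1 : ℕ → Prop := fun i => ∑ j ∈ range (i+1), w j ≤ W / ε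
  let P2 : ℕ → Prop := fun i => ∑ j ∈ range (i+1), w j / g j ≤ Θ
  have low := aux_low p hp0 hp1 n w g M (W / ε) hM (by positivity) hw hg hgM P1 (fun i _ h => h)
  have hθG : ∀ i < n, ¬ P1 i → θ ≤ ∑ j ∈ range (i+1), w j / g j := by
    intro i hi h
    have h1 : W / ε < ∑ j ∈ range (i+1), w j := not_le.1 h
    calc θ = (W / ε) / M := by rw [hθdef]; field_simp
      _ ≤ (∑ j ∈ range (i+1), w j) / M := by gcongr
      _ ≤ _ := by
        rw [sum_div]
        apply sum_le_sum
        intro j hj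
        have hj' : j < n := by have := mem_range.1 hj; omega
        have := hw j hj'; have := hg j hj'; have := hgM j hj'
        gcongr
  have lg := aux_log n (fun i => w i / g i) θ Θ hθ hΘ (fun i hi => div_nonneg (hw i hi) (hg i hi).le)
    (fun i => ¬ P1 i ∧ P2 i) (fun i _ h => h.2) (fun i hi h => hθG i hi h.1)
  have lg2 : 2 * Real.log ((θ + Θ) / θ) ≤ (2 * (1 + p⁻¹)) * L := by
    have e : (θ + Θ) / θ = 1 + (ε * T) ^ p⁻¹ := by rw [hΘdef]; field_simp
    rw [e]
    have : Real.log (1 + (ε * T) ^ p⁻¹) ≤ Real.log (2 * (ε * T) ^ p⁻¹) := by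
      apply Real.log_le_log (by positivity); linarith
    rw [Real.log_mul (by norm_num) (by positivity), Real.log_rpow hx0] at this
    have h2 : Real.log 2 ≤ 1 := by have := Real.log_two_lt_d9; linarith
    nlinarith
  have mid : ∑ i ∈ (range n).filter (fun i => ¬ P1 i ∧ P2 i),
      w i * (∑ j ∈ range (i+1), w j / g j) ^ (-p) ≤ ((2 * (1 + p⁻¹)) ^ p) *
          (∑ i ∈ range n, w i * (g i * L) ^ (p / (1-p))) ^ (1-p) := by
    have hs : ∀ i ∈ (range n).filter (fun i => ¬ P1 i ∧ P2 i), i < n := fun i hi =>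
      mem_range.1 (mem_filter.1 hi).1
    have hxn : ∀ i < n, 0 ≤ w i * g i ^ (p / (1-p)) := fun i hi =>
      mul_nonneg (hw i hi) (Real.rpow_nonneg (hg i hi).le _)
    rw [sum_congr rfl (fun i hi => aux_mid_term p (w i) (g i) _ hp0 hp1 (hw i (hs i hi))
      (hg i (hs i hi)) (hG0 (i+1) (hs i hi)))]
    have hyn : ∀ i ∈ (range n).filter (fun i => ¬ P1 i ∧ P2 i),
        0 ≤ (w i / g i) / (∑ j ∈ range (i+1), w j / g j) := fun i hi =>
      div_nonneg (div_nonneg (hw i (hs i hi)) (hg i (hs i hi)).le) (hG0 (i+1) (hs i hi))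
    refine (aux_holder p hp0 hp1 _ _ _ (fun i hi => hxn i (hs i hi)) hyn).trans ?_
    have hX : ∑ i ∈ (range n).filter (fun i => ¬ P1 i ∧ P2 i), w i * g i ^ (p / (1-p)) ≤
        ∑ i ∈ range n, w i * g i ^ (p / (1-p)) :=
      sum_le_sum_of_subset_of_nonneg (filter_subset _ _) fun i hi _ => hxn i (mem_range.1 hi)
    have hX0 : 0 ≤ ∑ i ∈ (range n).filter (fun i => ¬ P1 i ∧ P2 i), w i * g i ^ (p / (1-p)) :=
      sum_nonneg fun i hi => hxn i (hs i hi)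
    have hY0 := sum_nonneg hyn
    have hY := lg.trans lg2
    have hL0 : 0 ≤ L := by linarith
    have e : ∑ i ∈ range n, w i * (g i * L) ^ (p / (1-p)) =
        (∑ i ∈ range n, w i * g i ^ (p / (1-p))) * L ^ (p / (1-p)) := by
      rw [sum_mul]
      refine sum_congr rfl fun i hi => ?_
      rw [Real.mul_rpow (hg i (mem_range.1 hi)).le hL0]; ring
    rw [e, Real.mul_rpow (hX0.trans hX) (by positivity), ← Real.rpow_mul hL0,
      div_mul_cancel₀ _ hq.ne']
    calc _ ≤ (∑ i ∈ range n, w i * g i ^ (p / (1-p))) ^ (1-p) * ((2 * (1 + p⁻¹)) * L) ^ p := by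
          gcongr
          exact Real.rpow_nonneg (hX0.trans hX) _
      _ = _ := by
        rw [Real.mul_rpow (by positivity) hL0]; ring
  have high : ∑ i ∈ (range n).filter (fun i => ¬ P1 i ∧ ¬ P2 i),
      w i * (∑ j ∈ range (i+1), w j / g j) ^ (-p) ≤ M ^ p * (W / ε) ^ (1-p) := by
    have hb : ∀ i ∈ (range n).filter (fun i => ¬ P1 i ∧ ¬ P2 i),
      w i * (∑ j ∈ range (i+1), w j / g j) ^ (-p) ≤ W * Θ ^ (-p) := by
      intro i hi
      have hi' := mem_range.1 (mem_filter.1 hi).1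
      have h2 : Θ < ∑ j ∈ range (i+1), w j / g j := not_le.1 (mem_filter.1 hi).2.2
      have h3 : (∑ j ∈ range (i+1), w j / g j) ^ (-p) ≤ Θ ^ (-p) :=
        Real.rpow_le_rpow_of_nonpos hΘ h2.le (by linarith)
      have := hwW i hi'
      have := Real.rpow_nonneg (hΘ.le.trans h2.le) (-p)
      gcongr
    have hc := sum_le_card_nsmul _ _ _ hb
    refine hc.trans ?_
    have hcard : ((#((range n).filter (fun i => ¬ P1 i ∧ ¬ P2 i)) : ℕ) : ℝ) ≤ T := by
      have := card_filter_le (range n) (fun i => ¬ P1 i ∧ ¬ P2 i)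
      rw [card_range] at this
      exact_mod_cast this.trans hnT
    rw [nsmul_eq_mul]
    calc _ ≤ (T:ℝ) * (W * Θ ^ (-p)) := by gcongr
      _ = M ^ p * (W / ε) ^ (1-p) := by
        have e1 : ((ε * T) ^ p⁻¹) ^ (-p) = (ε * T)⁻¹ := by
          rw [← Real.rpow_mul hx0.le, mul_neg, inv_mul_cancel₀ hp0.ne', Real.rpow_neg_one]
        have e2 : θ ^ (-p) = M ^ p * (W / ε) ^ (-p) := by
          have : θ = (W / ε) / M := by rw [hθdef]; field_simp
          rw [this, Real.div_rpow (by positivity) hM.le, Real.rpow_neg hM.le, div_inv_eq_mul,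
            mul_comm]
        have e3 : (W / ε) ^ (1-p) = (W / ε) * (W / ε) ^ (-p) := by
          rw [sub_eq_add_neg, Real.rpow_add (by positivity), Real.rpow_one]
        rw [hΘdef, Real.mul_rpow hθ.le (by positivity), e1, e2, e3]
        have hT' : (T:ℝ) ≠ 0 := by
          rintro h; rw [h] at hx0; simp at hx0
        field_simp
  have split : ∑ i ∈ range n, w i * (∑ j ∈ range (i+1), w j / g j) ^ (-p) =
      ∑ i ∈ (range n).filter P1, w i * (∑ j ∈ range (i+1), w j / g j) ^ (-p)
      + (∑ i ∈ (range n).filter (fun i => ¬ P1 i ∧ P2 i),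
          w i * (∑ j ∈ range (i+1), w j / g j) ^ (-p)
      + ∑ i ∈ (range n).filter (fun i => ¬ P1 i ∧ ¬ P2 i),
          w i * (∑ j ∈ range (i+1), w j / g j) ^ (-p)) := by
    rw [← sum_filter_add_sum_filter_not (range n) P1]
    congr 1
    rw [← sum_filter_add_sum_filter_not ((range n).filter (fun i => ¬ P1 i)) P2, filter_filter,
      filter_filter]
  rw [split]
  linarith

lemma aux_core (p : ℝ) (hp0 : 0 < p) (hp1 : p < 1) (n T : ℕ) (hnT : n ≤ T) (w g : ℕ → ℝ)
    (M W ε : ℝ) (hM : 0 < M) (hW : 0 ≤ W) (hε : 0 < ε) (hx : 1 ≤ ε * T)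
    (hw : ∀ i < n, 0 ≤ w i) (hwW : ∀ i < n, w i ≤ W)
    (hg : ∀ i < n, 0 < g i) (hgM : ∀ i < n, g i ≤ M) :
    ∑ i ∈ range n, w i * (∑ j ∈ range (i+1), w j / g j) ^ (-p)
      ≤ ((2 * (1 + p⁻¹)) ^ p + 3 * (1-p)⁻¹ + 1) *
          ((∑ i ∈ range n, w i * (g i * Real.log (ε * T)) ^ (p / (1-p))) ^ (1-p)
        + M ^ p * (W / ε) ^ (1-p)) := by
  have hq : 0 < 1 - p := by linarith
  have hL0 : 0 ≤ Real.log (ε * T) := Real.log_nonneg hx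
  have hA : 0 ≤ (∑ i ∈ range n, w i * (g i * Real.log (ε * T)) ^ (p / (1-p))) ^ (1-p) := by
    apply Real.rpow_nonneg
    refine sum_nonneg fun i hi => ?_
    have := hw i (mem_range.1 hi); have := hg i (mem_range.1 hi)
    positivity
  have hB : 0 ≤ M ^ p * (W / ε) ^ (1-p) := by positivity
  have hC : 0 ≤ (2 * (1 + p⁻¹)) ^ p := by positivity
  have hD : 0 ≤ (1-p)⁻¹ := by positivity
  by_cases h : 0 < W ∧ 1 ≤ Real.log (ε * T)
  · have := aux_core1 p hp0 hp1 n T hnT w g M W ε hM h.1 hε h.2 hw hwW hg hgM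
    nlinarith [mul_nonneg hC hA, mul_nonneg hC hB, mul_nonneg hD hA, mul_nonneg hD hB]
  · have h2 := aux_bound2 p hp0 hp1 n w g M hM hw hg hgM
    have hS : ∑ i ∈ range n, w i ≤ T * W := by
      have := sum_le_card_nsmul (range n) w W (fun i hi => hwW i (mem_range.1 hi))
      rw [card_range, nsmul_eq_mul] at this
      have hh : (n:ℝ) ≤ T := by exact_mod_cast hnT
      nlinarith
    have hS0 : 0 ≤ ∑ i ∈ range n, w i := sum_nonneg fun i hi => hw i (mem_range.1 hi)
    have h3 : (∑ i ∈ range n, w i) ^ (1-p) ≤ 3 * (W / ε) ^ (1-p) := by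
      rcases hW.eq_or_lt with h0 | h0
      · subst h0
        have : ∑ i ∈ range n, w i = 0 := by linarith
        rw [this]; simp [Real.zero_rpow hq.ne']
      · have hl : Real.log (ε * T) < 1 := by
          by_contra hh; exact h ⟨h0, not_lt.1 hh⟩
        have hx3 : ε * T ≤ 3 := by
          rw [Real.log_lt_iff_lt_exp (by linarith)] at hl
          have := Real.exp_one_lt_d9; linarith
        have e : (T:ℝ) * W = (ε * T) * (W / ε) := by field_simp
        calc (∑ i ∈ range n, w i) ^ (1-p) ≤ (3 * (W / ε)) ^ (1-p) := by
              apply Real.rpow_le_rpow hS0 _ hq.le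
              rw [e] at hS
              refine hS.trans ?_
              gcongr
          _ = 3 ^ (1-p) * (W / ε) ^ (1-p) := Real.mul_rpow (by norm_num) (by positivity)
          _ ≤ _ := by
            gcongr
            calc (3:ℝ) ^ (1-p) ≤ 3 ^ (1:ℝ) := Real.rpow_le_rpow_of_exponent_le (by norm_num) (by linarith)
              _ = 3 := by simp
    have h4 : (1 - p)⁻¹ * (M ^ p * (∑ i ∈ range n, w i) ^ (1-p)) ≤
        (1 - p)⁻¹ * (M ^ p * (3 * (W / ε) ^ (1-p))) := by gcongr
    nlinarith [mul_nonneg hC hA, mul_nonneg hC hB, mul_nonneg hD hA, mul_nonneg hD hB]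

lemma aux_part (k : ℕ) (hk : 2 ≤ k) (n T : ℕ) (hnT : n ≤ T) (w g r : ℕ → ℝ)
    (M W ε : ℝ) (hM : 0 < M) (hW : 0 ≤ W) (hε : 0 < ε) (hx : 1 ≤ ε * T)
    (hw : ∀ i < n, 0 ≤ w i) (hwW : ∀ i < n, w i ≤ W)
    (hg : ∀ i < n, 0 < g i) (hgM : ∀ i < n, g i ≤ M)
    (hr : ∀ i ≤ n, 0 < r i) (hrm : ∀ i < n, r i ≤ r (i+1))
    (hrk : ∀ i < n, r i ^ k + w i / g i ≤ r (i+1) ^ k) :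
    ∑ i ∈ range n, w i / r i ≤ W / r 0 + 10 *
      min ((∑ i ∈ range n, w i * (g i * Real.log (ε * T)) ^ ((k:ℝ)⁻¹ / (1-(k:ℝ)⁻¹))) ^ (1-(k:ℝ)⁻¹)
          + M ^ (k:ℝ)⁻¹ * (W / ε) ^ (1-(k:ℝ)⁻¹))
        (M ^ (k:ℝ)⁻¹ * (∑ i ∈ range n, w i) ^ (1-(k:ℝ)⁻¹)) := by
  have hk' : (2:ℝ) ≤ k := by exact_mod_cast hk
  set p : ℝ := (k:ℝ)⁻¹ with hp
  have hp0 : 0 < p := by positivity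
  have hp2 : p ≤ 1/2 := by
    rw [hp, inv_le_comm₀ (by positivity) (by norm_num)]; linarith
  have hp1 : p < 1 := by linarith
  have hq : 0 < 1 - p := by linarith
  have hGr : ∀ i ≤ n, ∑ j ∈ range i, w j / g j ≤ r i ^ k := by
    intro i
    induction i with
    | zero => intro h; have := hr 0 h; simp; positivity
    | succ i ih =>
      intro h
      rw [sum_range_succ]
      have := ih (by omega); have := hrk i (by omega)
      linarith
  have h1 : ∀ i < n, w i / r (i+1) ≤ w i * (∑ j ∈ range (i+1), w j / g j) ^ (-p) := by
    intro i hi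
    rcases (hw i hi).eq_or_lt with h0 | h0
    · simp [← h0]
    have hGp : 0 < ∑ j ∈ range (i+1), w j / g j := by
      rw [sum_range_succ]
      have : 0 ≤ ∑ j ∈ range i, w j / g j := sum_nonneg fun j hj => by
        have hj' : j < n := by have := mem_range.1 hj; omega
        exact div_nonneg (hw j hj') (hg j hj').le
      have := div_pos h0 (hg i hi)
      linarith
    have hr1 := hr (i+1) hi
    rw [div_eq_mul_inv]
    gcongr
    have : r (i+1) ^ (-1:ℝ) = (r (i+1) ^ k) ^ (-p) := by
      rw [← Real.rpow_natCast, ← Real.rpow_mul hr1.le, mul_neg, hp, mul_inv_cancel₀ (by positivity)]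
    rw [← Real.rpow_neg_one, this]
    exact Real.rpow_le_rpow_of_nonpos hGp (hGr (i+1) hi) (by linarith)
  have h2 : ∑ i ∈ range n, (w i / r i - w i / r (i+1)) ≤ W / r 0 := by
    have : ∀ m ≤ n, ∑ i ∈ range m, (w i / r i - w i / r (i+1)) ≤ W / r 0 - W / r m := by
      intro m
      induction m with
      | zero => simp
      | succ m ih =>
        intro h
        rw [sum_range_succ]
        have h3 := ih (by omega)
        have h4 : 1 / r (m+1) ≤ 1 / r m :=
          one_div_le_one_div_of_le (hr m (by omega)) (hrm m (by omega))
        have h5 := hwW m (by omega)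
        have e1 : ∀ x y : ℝ, x / y = x * (1 / y) := fun x y => by ring
        rw [e1 W (r (m+1))]
        rw [e1 W (r m)] at h3
        rw [e1 (w m) (r m), e1 (w m) (r (m+1))]
        nlinarith
    have h3 := this n le_rfl
    have := div_nonneg hW (hr n le_rfl).le
    linarith
  rw [sum_sub_distrib] at h2
  have h3 : ∑ i ∈ range n, w i / r (i+1) ≤
      ∑ i ∈ range n, w i * (∑ j ∈ range (i+1), w j / g j) ^ (-p) :=
    sum_le_sum fun i hi => h1 i (mem_range.1 hi)
  have c1 := aux_core p hp0 hp1 n T hnT w g M W ε hM hW hε hx hw hwW hg hgM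
  have c2 := aux_bound2 p hp0 hp1 n w g M hM hw hg hgM
  have hD : (1-p)⁻¹ ≤ 2 := by
    rw [inv_le_comm₀ hq (by norm_num)]; linarith
  have hD0 : 0 ≤ (1-p)⁻¹ := by positivity
  have hC : (2 * (1 + p⁻¹)) ^ p ≤ 3 := by
    have e : p⁻¹ = k := by rw [hp, inv_inv]
    have h6 : (2 * (1 + (k:ℝ))) ≤ 3 ^ k := by
      clear_value p
      clear * - hk
      induction k, hk using Nat.le_induction with
      | base => norm_num
      | succ m hm ih =>
        have hm' : (2:ℝ) ≤ m := by exact_mod_cast hm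
        rw [pow_succ]; push_cast; linarith
    rw [e]
    calc (2 * (1 + (k:ℝ))) ^ p ≤ ((3:ℝ) ^ k) ^ p := by gcongr
      _ = 3 := by rw [hp]; exact Real.pow_rpow_inv_natCast (by norm_num) (by omega)
  have hL0 : 0 ≤ Real.log (ε * T) := Real.log_nonneg hx
  have hA : 0 ≤ (∑ i ∈ range n, w i * (g i * Real.log (ε * T)) ^ (p / (1-p))) ^ (1-p) := by
    apply Real.rpow_nonneg
    refine sum_nonneg fun i hi => ?_
    have := hw i (mem_range.1 hi); have := hg i (mem_range.1 hi)
    positivity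
  have hB : 0 ≤ M ^ p * (W / ε) ^ (1-p) := by positivity
  have hE : 0 ≤ M ^ p * (∑ i ∈ range n, w i) ^ (1-p) := by
    have : 0 ≤ ∑ i ∈ range n, w i := sum_nonneg fun i hi => hw i (mem_range.1 hi)
    positivity
  have h7 : ∑ i ∈ range n, w i / r i - W / r 0 ≤ ∑ i ∈ range n, w i / r (i+1) := by linarith
  rw [← sub_le_iff_le_add', mul_min_of_nonneg _ _ (by norm_num)]
  refine le_min ((h7.trans (h3.trans c1)).trans ?_) ((h7.trans (h3.trans c2)).trans ?_)
  · apply mul_le_mul_of_nonneg_right _ (add_nonneg hA hB)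
    linarith
  · apply mul_le_mul_of_nonneg_right _ hE
    linarith

lemma aux_Icc (f : ℕ → ℝ) (m : ℕ) : ∑ t ∈ Icc 1 m, f t = ∑ i ∈ range m, f (i+1) := by
  induction m with
  | zero => simp
  | succ m ih => rw [sum_Icc_succ_top (by omega), sum_range_succ, ih]

theorem stmt_6 :
    ∃ K : ℝ, 0 < K ∧
      ∀ (T : ℕ) (hT : 1 ≤ T) (z u h hhat β : ℕ → ℝ),
        (∀ t ∈ Finset.Icc 1 T, 0 ≤ z t) →
        (∀ t ∈ Finset.Icc 1 T, 0 ≤ u t) →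
        (∀ t ∈ Finset.Icc 1 T, 0 < h t) →
        (∀ t ∈ Finset.Icc 1 (T + 1), 0 < hhat t) →
        (∀ t ∈ Finset.Icc 1 T, h t ≤ hhat t) →
        β 0 = 0 →
        0 < β 1 →
        (∀ t ∈ Finset.Icc 2 T,
          β t = β (t - 1)
            + (1 / hhat t) * (2 * Real.sqrt (z (t - 1) / β (t - 1)) + u (t - 1) / β (t - 1))) →
        ∀ ε : ℝ, 1 / (T : ℝ) ≤ ε →
          F T β z u h ≤ K *
            (min
              ((∑ t ∈ Finset.Icc 1 T,
                  Real.sqrt (z t * hhat (t + 1) * Real.log (ε * T))) ^ ((2 : ℝ) / 3)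
                + (Real.sqrt
                      (((Finset.Icc 1 T).sup' (Finset.nonempty_Icc.mpr hT) z)
                        * ((Finset.Icc 1 T).sup' (Finset.nonempty_Icc.mpr hT) hhat)) / ε)
                    ^ ((2 : ℝ) / 3))
              ((∑ t ∈ Finset.Icc 1 T,
                  Real.sqrt (z t
                    * ((Finset.Icc 1 T).sup' (Finset.nonempty_Icc.mpr hT) hhat)))
                ^ ((2 : ℝ) / 3))
            + min
              (Real.sqrt (∑ t ∈ Finset.Icc 1 T, u t * hhat (t + 1) * Real.log (ε * T))
                + Real.sqrt
                    (((Finset.Icc 1 T).sup' (Finset.nonempty_Icc.mpr hT) u)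
                      * ((Finset.Icc 1 T).sup' (Finset.nonempty_Icc.mpr hT) hhat) / ε))
              (Real.sqrt (∑ t ∈ Finset.Icc 1 T,
                  u t * ((Finset.Icc 1 T).sup' (Finset.nonempty_Icc.mpr hT) hhat)))
            + Real.sqrt (((Finset.Icc 1 T).sup' (Finset.nonempty_Icc.mpr hT) z) / β 1)
            + ((Finset.Icc 1 T).sup' (Finset.nonempty_Icc.mpr hT) u) / β 1
            + β 1 * h 1) := by
  refine ⟨40, by norm_num, ?_⟩
  intro T hT z u h hhat β hz hu hh hhh hle hβ0 hβ1 hrule ε hε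
  obtain ⟨n, rfl⟩ : ∃ n, T = n + 1 := ⟨T - 1, by omega⟩
  set zm := (Finset.Icc 1 (n+1)).sup' (Finset.nonempty_Icc.mpr hT) z with hzm
  set um := (Finset.Icc 1 (n+1)).sup' (Finset.nonempty_Icc.mpr hT) u with hum
  set M := (Finset.Icc 1 (n+1)).sup' (Finset.nonempty_Icc.mpr hT) hhat with hMdef
  have hzle : ∀ i ≤ n, z (i+1) ≤ zm := fun i hi =>
    Finset.le_sup' z (mem_Icc.2 ⟨by omega, by omega⟩)
  have hule : ∀ i ≤ n, u (i+1) ≤ um := fun i hi =>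
    Finset.le_sup' u (mem_Icc.2 ⟨by omega, by omega⟩)
  have hgle : ∀ i ≤ n, hhat (i+1) ≤ M := fun i hi =>
    Finset.le_sup' hhat (mem_Icc.2 ⟨by omega, by omega⟩)
  clear_value zm um M
  have hz' : ∀ i ≤ n, 0 ≤ z (i+1) := fun i hi => hz _ (mem_Icc.2 ⟨by omega, by omega⟩)
  have hu' : ∀ i ≤ n, 0 ≤ u (i+1) := fun i hi => hu _ (mem_Icc.2 ⟨by omega, by omega⟩)
  have hg' : ∀ i ≤ n + 1, 0 < hhat (i+1) := fun i hi => hhh _ (mem_Icc.2 ⟨by omega, by omega⟩)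
  have hM : 0 < M := (hg' 0 (by omega)).trans_le (hgle 0 (by omega))
  have hzm0 : 0 ≤ zm := (hz' 0 (by omega)).trans (hzle 0 (by omega))
  have hum0 : 0 ≤ um := (hu' 0 (by omega)).trans (hule 0 (by omega))
  have hTpos : (0:ℝ) < ((n+1 : ℕ) : ℝ) := by positivity
  have hε0 : 0 < ε := lt_of_lt_of_le (by positivity) hε
  have hx : 1 ≤ ε * ((n+1 : ℕ) : ℝ) := by rwa [div_le_iff₀ hTpos] at hε
  have hrule' : ∀ i < n, β (i+2) = β (i+1) + (1 / hhat (i+2)) *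
      (2 * Real.sqrt (z (i+1) / β (i+1)) + u (i+1) / β (i+1)) := fun i hi => by
    have := hrule (i+2) (mem_Icc.2 ⟨by omega, by omega⟩)
    simpa using this
  have hb : ∀ i ≤ n, β 1 ≤ β (i+1) := by
    intro i
    induction i with
    | zero => intro _; exact le_rfl
    | succ i ih =>
      intro hi
      have h1 := ih (by omega)
      have h2 := hrule' i (by omega)
      have h3 := hg' (i+1) (by omega)
      have h4 := hu' i (by omega)
      have h5 : 0 < β (i+1) := by linarith
      have : 0 ≤ (1 / hhat (i+2)) *
        (2 * Real.sqrt (z (i+1) / β (i+1)) + u (i+1) / β (i+1)) := by positivity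
      show β 1 ≤ β (i+2)
      linarith
  have hbpos : ∀ i ≤ n, 0 < β (i+1) := fun i hi => hβ1.trans_le (hb i hi)
  have hsq : ∀ i ≤ n, Real.sqrt (z (i+1) / β (i+1)) = Real.sqrt (z (i+1)) / Real.sqrt (β (i+1)) :=
    fun i hi => Real.sqrt_div (hz' i hi) _
  have hincz : ∀ i < n, β (i+1) + Real.sqrt (z (i+1)) / Real.sqrt (β (i+1)) / hhat (i+2) ≤ β (i+2) := by
    intro i hi
    rw [hrule' i hi, hsq i hi.le]
    have h3 := hg' (i+1) (by omega)
    have h4 := hu' i (by omega)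
    have h5 := hbpos i hi.le
    have : 0 ≤ (1 / hhat (i+2)) *
        (Real.sqrt (z (i+1)) / Real.sqrt (β (i+1)) + u (i+1) / β (i+1)) := by positivity
    have e : (1 / hhat (i+2)) * (2 * (Real.sqrt (z (i+1)) / Real.sqrt (β (i+1))) + u (i+1) / β (i+1))
      = Real.sqrt (z (i+1)) / Real.sqrt (β (i+1)) / hhat (i+2) + (1 / hhat (i+2)) *
        (Real.sqrt (z (i+1)) / Real.sqrt (β (i+1)) + u (i+1) / β (i+1)) := by ring
    rw [e]; linarith
  have hincu : ∀ i < n, β (i+1) + u (i+1) / β (i+1) / hhat (i+2) ≤ β (i+2) := by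
    intro i hi
    rw [hrule' i hi]
    have h3 := hg' (i+1) (by omega)
    have : 0 ≤ (1 / hhat (i+2)) * (2 * Real.sqrt (z (i+1) / β (i+1))) := by positivity
    have e : (1 / hhat (i+2)) * (2 * Real.sqrt (z (i+1) / β (i+1)) + u (i+1) / β (i+1))
      = u (i+1) / β (i+1) / hhat (i+2) + (1 / hhat (i+2)) * (2 * Real.sqrt (z (i+1) / β (i+1))) := by
        ring
    rw [e]; linarith
  have hmono : ∀ i < n, β (i+1) ≤ β (i+2) := by
    intro i hi
    have h1 := hincu i hi
    have h3 := hg' (i+1) (by omega)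
    have h4 := hu' i (by omega)
    have h5 := hbpos i hi.le
    have : 0 ≤ u (i+1) / β (i+1) / hhat (i+2) := by positivity
    linarith
  have partz := aux_part 3 (by norm_num) n (n+1) (by omega) (fun i => Real.sqrt (z (i+1)))
    (fun i => hhat (i+2)) (fun i => Real.sqrt (β (i+1))) M (Real.sqrt zm) ε hM (Real.sqrt_nonneg _)
    hε0 hx (fun i _ => Real.sqrt_nonneg _) (fun i hi => Real.sqrt_le_sqrt (hzle i hi.le))
    (fun i hi => hg' (i+1) (by omega)) (fun i hi => hgle (i+1) (by omega))
    (fun i hi => Real.sqrt_pos.2 (hbpos i hi)) (fun i hi => Real.sqrt_le_sqrt (hmono i hi))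
    (by
      intro i hi
      have h1 := hincz i hi
      have h2 := Real.sqrt_le_sqrt (hmono i hi)
      have h3 := Real.sqrt_pos.2 (hbpos i hi.le)
      have h4 := Real.sq_sqrt (hbpos i hi.le).le
      have h5 := Real.sq_sqrt ((hbpos i hi.le).le.trans (hmono i hi))
      have h6 := hg' (i+1) (by omega)
      show Real.sqrt (β (i+1)) ^ 3 + Real.sqrt (z (i+1)) / hhat (i+2) ≤ Real.sqrt (β (i+2)) ^ 3
      rw [← h4, ← h5] at h1
      rw [Real.sqrt_sq h3.le] at h1
      set r := Real.sqrt (β (i+1))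
      set r' := Real.sqrt (β (i+2))
      set c := Real.sqrt (z (i+1)) / r / hhat (i+2) with hc
      have hc0 : 0 ≤ c := by positivity
      have e : Real.sqrt (z (i+1)) / hhat (i+2) = r * c := by rw [hc]; field_simp
      rw [e]
      have hr' : 0 < r' := h3.trans_le h2
      calc r ^ 3 + r * c = r * (r ^ 2 + c) := by ring
        _ ≤ r' * r' ^ 2 := by gcongr
        _ = r' ^ 3 := by ring)
  have partu := aux_part 2 (by norm_num) n (n+1) (by omega) (fun i => u (i+1))
    (fun i => hhat (i+2)) (fun i => β (i+1)) M um ε hM hum0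
    hε0 hx (fun i hi => hu' i hi.le) (fun i hi => hule i hi.le)
    (fun i hi => hg' (i+1) (by omega)) (fun i hi => hgle (i+1) (by omega))
    (fun i hi => hbpos i hi) (fun i hi => hmono i hi)
    (by
      intro i hi
      have h1 := hincu i hi
      have h2 := hmono i hi
      have h3 := hbpos i hi.le
      have h6 := hg' (i+1) (by omega)
      have h7 := hu' i hi.le
      show β (i+1) ^ 2 + u (i+1) / hhat (i+2) ≤ β (i+2) ^ 2
      set r := β (i+1)
      set r' := β (i+2)
      set c := u (i+1) / r / hhat (i+2) with hc
      have hc0 : 0 ≤ c := by positivity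
      have e : u (i+1) / hhat (i+2) = r * c := by rw [hc]; field_simp
      rw [e]
      have hr' : 0 < r' := h3.trans_le h2
      calc r ^ 2 + r * c = r * (r + c) := by ring
        _ ≤ r' * r' := by gcongr
        _ = r' ^ 2 := by ring)
  have hL0 : 0 ≤ Real.log (ε * ((n+1 : ℕ) : ℝ)) := Real.log_nonneg hx
  set L := Real.log (ε * ((n+1 : ℕ) : ℝ)) with hL
  clear_value L
  have ez1 : ((3:ℕ):ℝ)⁻¹ / (1 - ((3:ℕ):ℝ)⁻¹) = 1/2 := by norm_num
  have ez2 : 1 - ((3:ℕ):ℝ)⁻¹ = 2/3 := by norm_num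
  have eu1 : ((2:ℕ):ℝ)⁻¹ / (1 - ((2:ℕ):ℝ)⁻¹) = 1 := by norm_num
  have eu2 : 1 - ((2:ℕ):ℝ)⁻¹ = 1/2 := by norm_num
  rw [ez1, ez2] at partz
  rw [eu1, eu2] at partu
  -- compare the minima
  have hMz : M ^ ((3:ℕ):ℝ)⁻¹ = Real.sqrt M ^ ((2:ℝ)/3) := by
    rw [Real.sqrt_eq_rpow, ← Real.rpow_mul hM.le]; norm_num
  have hMu : M ^ ((2:ℕ):ℝ)⁻¹ = Real.sqrt M := by
    rw [Real.sqrt_eq_rpow]; norm_num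
  rw [hMz] at partz
  rw [hMu] at partu
  have mz : min ((∑ i ∈ range n, Real.sqrt (z (i+1)) * (hhat (i+2) * L) ^ ((1:ℝ)/2)) ^ ((2:ℝ)/3)
          + Real.sqrt M ^ ((2:ℝ)/3) * (Real.sqrt zm / ε) ^ ((2:ℝ)/3))
        (Real.sqrt M ^ ((2:ℝ)/3) * (∑ i ∈ range n, Real.sqrt (z (i+1))) ^ ((2:ℝ)/3)) ≤
      min ((∑ t ∈ Icc 1 (n+1), Real.sqrt (z t * hhat (t + 1) * L)) ^ ((2 : ℝ) / 3)
                + (Real.sqrt (zm * M) / ε) ^ ((2 : ℝ) / 3))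
              ((∑ t ∈ Icc 1 (n+1), Real.sqrt (z t * M)) ^ ((2 : ℝ) / 3)) := by
    apply min_le_min
    · apply add_le_add
      · apply Real.rpow_le_rpow _ _ (by norm_num)
        · refine sum_nonneg fun i hi => ?_
          have := hg' (i+1) (by have := mem_range.1 hi; omega)
          positivity
        · rw [aux_Icc, sum_range_succ]
          have : ∑ i ∈ range n, Real.sqrt (z (i+1)) * (hhat (i+2) * L) ^ ((1:ℝ)/2) =
              ∑ i ∈ range n, Real.sqrt (z (i+1) * hhat (i+1+1) * L) := by
            refine sum_congr rfl fun i hi => ?_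
            rw [← Real.sqrt_eq_rpow, mul_assoc, Real.sqrt_mul (hz' i (mem_range.1 hi).le)]
          rw [this]
          exact le_add_of_nonneg_right (Real.sqrt_nonneg _)
      · rw [← Real.mul_rpow (Real.sqrt_nonneg _) (by positivity), Real.sqrt_mul hzm0]
        apply le_of_eq
        congr 1
        ring
    · rw [← Real.mul_rpow (Real.sqrt_nonneg _) (sum_nonneg fun i _ => Real.sqrt_nonneg _)]
      apply Real.rpow_le_rpow _ _ (by norm_num)
      · exact mul_nonneg (Real.sqrt_nonneg _) (sum_nonneg fun i _ => Real.sqrt_nonneg _)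
      · rw [aux_Icc, sum_range_succ, mul_sum]
        have : ∑ i ∈ range n, Real.sqrt M * Real.sqrt (z (i+1)) =
              ∑ i ∈ range n, Real.sqrt (z (i+1) * M) := by
          refine sum_congr rfl fun i hi => ?_
          rw [Real.sqrt_mul (hz' i (mem_range.1 hi).le), mul_comm]
        rw [this]
        exact le_add_of_nonneg_right (Real.sqrt_nonneg _)
  have mu : min ((∑ i ∈ range n, u (i+1) * (hhat (i+2) * L) ^ (1:ℝ)) ^ ((1:ℝ)/2)
          + Real.sqrt M * (um / ε) ^ ((1:ℝ)/2))
        (Real.sqrt M * (∑ i ∈ range n, u (i+1)) ^ ((1:ℝ)/2)) ≤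
      min (Real.sqrt (∑ t ∈ Icc 1 (n+1), u t * hhat (t + 1) * L)
                + Real.sqrt (um * M / ε))
              (Real.sqrt (∑ t ∈ Icc 1 (n+1), u t * M)) := by
    simp only [← Real.sqrt_eq_rpow, Real.rpow_one]
    apply min_le_min
    · apply add_le_add
      · apply Real.sqrt_le_sqrt
        rw [aux_Icc, sum_range_succ]
        have : ∑ i ∈ range n, u (i+1) * (hhat (i+2) * L) =
              ∑ i ∈ range n, u (i+1) * hhat (i+1+1) * L :=
          sum_congr rfl fun i hi => by ring
        rw [this]
        have h1 := hu' n le_rfl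
        have h2 := hg' (n+1) le_rfl
        exact le_add_of_nonneg_right (by positivity)
      · rw [← Real.sqrt_mul hM.le]
        apply le_of_eq
        congr 1
        ring
    · rw [← Real.sqrt_mul hM.le]
      apply Real.sqrt_le_sqrt
      rw [aux_Icc, sum_range_succ, mul_sum]
      have : ∑ i ∈ range n, M * u (i+1) = ∑ i ∈ range n, u (i+1) * M :=
        sum_congr rfl fun i hi => by ring
      rw [this]
      have h1 := hu' n le_rfl
      exact le_add_of_nonneg_right (by positivity)
  have mz0 : 0 ≤ min ((∑ t ∈ Icc 1 (n+1), Real.sqrt (z t * hhat (t + 1) * L)) ^ ((2 : ℝ) / 3)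
                + (Real.sqrt (zm * M) / ε) ^ ((2 : ℝ) / 3))
              ((∑ t ∈ Icc 1 (n+1), Real.sqrt (z t * M)) ^ ((2 : ℝ) / 3)) := by
    apply le_min <;> positivity
  have mu0 : 0 ≤ min (Real.sqrt (∑ t ∈ Icc 1 (n+1), u t * hhat (t + 1) * L)
                + Real.sqrt (um * M / ε))
              (Real.sqrt (∑ t ∈ Icc 1 (n+1), u t * M)) := by
    apply le_min <;> positivity
  have partz' := partz.trans (add_le_add_right (mul_le_mul_of_nonneg_left mz (by norm_num)) _)
  have partu' := partu.trans (add_le_add_right (mul_le_mul_of_nonneg_left mu (by norm_num)) _)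
  clear partz partu mz mu
  set mZ := min ((∑ t ∈ Icc 1 (n+1), Real.sqrt (z t * hhat (t + 1) * L)) ^ ((2 : ℝ) / 3)
                + (Real.sqrt (zm * M) / ε) ^ ((2 : ℝ) / 3))
              ((∑ t ∈ Icc 1 (n+1), Real.sqrt (z t * M)) ^ ((2 : ℝ) / 3))
  set mU := min (Real.sqrt (∑ t ∈ Icc 1 (n+1), u t * hhat (t + 1) * L)
                + Real.sqrt (um * M / ε))
              (Real.sqrt (∑ t ∈ Icc 1 (n+1), u t * M))
  clear_value mZ mU
  have hF : F (n+1) β z u h ≤ 2 * (2 * ∑ i ∈ range n, Real.sqrt (z (i+1)) / Real.sqrt (β (i+1))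
      + ∑ i ∈ range n, u (i+1) / β (i+1)) + (2 * Real.sqrt (zm / β 1) + um / β 1) + β 1 * h 1 := by
    unfold F
    rw [aux_Icc, sum_add_distrib, sum_range_succ, sum_range_succ' (fun i => (β (i+1) - β (i+1-1)) * h (i+1))]
    have f1 : 2 * Real.sqrt (z (n+1) / β (n+1)) + u (n+1) / β (n+1) ≤
        2 * Real.sqrt (zm / β 1) + um / β 1 := by
      have h1 := hb n le_rfl
      have h2 := hzle n le_rfl
      have h3 := hule n le_rfl
      have h4 := hz' n le_rfl
      gcongr
    have f2 : ∑ i ∈ range n, (2 * Real.sqrt (z (i+1) / β (i+1)) + u (i+1) / β (i+1)) =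
        2 * ∑ i ∈ range n, Real.sqrt (z (i+1)) / Real.sqrt (β (i+1))
      + ∑ i ∈ range n, u (i+1) / β (i+1) := by
      rw [sum_add_distrib, mul_sum]
      congr 1
      exact sum_congr rfl fun i hi => by rw [hsq i (mem_range.1 hi).le]
    have f3 : ∑ i ∈ range n, (β (i+1+1) - β (i+1+1-1)) * h (i+1+1) ≤
        ∑ i ∈ range n, (2 * Real.sqrt (z (i+1) / β (i+1)) + u (i+1) / β (i+1)) := by
      apply sum_le_sum
      intro i hi
      have hi' := mem_range.1 hi
      have h1 := hrule' i hi'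
      have h2 := hle (i+2) (mem_Icc.2 ⟨by omega, by omega⟩)
      have h3 := hg' (i+1) (by omega)
      have h4 := hu' i hi'.le
      have h5 := hbpos i hi'.le
      show (β (i+2) - β (i+1)) * h (i+2) ≤ _
      rw [h1, add_sub_cancel_left]
      have h6 : 0 ≤ 2 * Real.sqrt (z (i+1) / β (i+1)) + u (i+1) / β (i+1) := by positivity
      set A := 2 * Real.sqrt (z (i+1) / β (i+1)) + u (i+1) / β (i+1)
      have h3' : 0 < hhat (i+2) := h3
      calc 1 / hhat (i+2) * A * h (i+2) ≤ 1 / hhat (i+2) * A * hhat (i+2) := by gcongr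
        _ = A := by field_simp
    have f4 : (β (0+1) - β (0+1-1)) * h (0+1) = β 1 * h 1 := by simp [hβ0]
    rw [f4]
    linarith
  have e0 : Real.sqrt zm / Real.sqrt (β (0+1)) = Real.sqrt (zm / β 1) := (Real.sqrt_div hzm0 _).symm
  have e0' : um / β (0+1) = um / β 1 := rfl
  rw [e0] at partz'
  rw [e0'] at partu'
  have g1 : 0 ≤ Real.sqrt (zm / β 1) := Real.sqrt_nonneg _
  have g2 : 0 ≤ um / β 1 := by positivity
  have g3 : 0 ≤ β 1 * h 1 := mul_nonneg hβ1.le (hh 1 (mem_Icc.2 ⟨le_rfl, hT⟩)).le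
  linarith
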